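/- Let κ ≥ |L| + ℵ₀ and let T be a κ-categorical first-order L-theory with an infinite model. Then Mod(T) is bitotally bisimilar with a potentialist system all of whose worlds are models of T of cardinality less than κ, except for exactly one world, which has cardinality κ. -/

import Mathlib

open FirstOrder Language

namespace Potentialist

/-- The underlying data of a potentialist system: a collection of worlds, each carrying a
first-order `L`-structure. -/
structure PreSys.{u, v, w, x} (L : FirstOrder.Language.{u, v}) where
  World : Type w
  Dom : World → Type x
  str : ∀ W, L.Structure (Dom W)

attribute [instance] PreSys.str

/-- A potentialist system: a collection of first-order `L`-structures together with a
collection of `L`-embeddings between them, containing all identity embeddings and closed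
under composition. -/
structure PotSys.{u, v, w, x} (L : FirstOrder.Language.{u, v})
    extends PreSys.{u, v, w, x} L where
  Emb : ∀ W W' : World, Set (Dom W ↪[L] Dom W')
  id_mem : ∀ W : World, Embedding.refl L (Dom W) ∈ Emb W W
  comp_mem : ∀ {W W' W'' : World} (f : Dom W ↪[L] Dom W') (g : Dom W' ↪[L] Dom W''),
    f ∈ Emb W W' → g ∈ Emb W' W'' → g.comp f ∈ Emb W W''

/-- Two tuples (in possibly different structures) satisfy the same atomic `L`-formulas. -/
def AtomicEquiv.{u, v, y, z} (L : FirstOrder.Language.{u, v}) {M : Type y} {N : Type z}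
    [L.Structure M] [L.Structure N] {n : ℕ} (a : Fin n → M) (b : Fin n → N) : Prop :=
  ∀ φ : L.Formula (Fin n), BoundedFormula.IsAtomic φ → (φ.Realize a ↔ φ.Realize b)

/-- The type of relations between pairs `(M, ā)` and `(N, b̄)` of equal parameter size. -/
abbrev BisimRel.{u, v, w, x, w', x'} {L : FirstOrder.Language.{u, v}}
    (S : PotSys.{u, v, w, x} L) (T : PotSys.{u, v, w', x'} L) :=
  ∀ (n : ℕ) (M : S.World), (Fin n → S.Dom M) → ∀ N : T.World, (Fin n → T.Dom N) → Prop

/-- `R` is a bisimulation between the potentialist systems `S` and `T`: it is nonempty, and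
whenever `R` relates `(M, ā)` to `(N, b̄)`: (B1) `ā` and `b̄` satisfy the same atomic formulas;
(B2) any extension of either tuple by one element can be matched on the other side;
(B3) any embedding on either side can be matched by an embedding on the other side. -/
def IsBisimulation.{u, v, w, x, w', x'} {L : FirstOrder.Language.{u, v}}
    (S : PotSys.{u, v, w, x} L) (T : PotSys.{u, v, w', x'} L) (R : BisimRel S T) : Prop :=
  (∃ n M a N b, R n M a N b) ∧
  ∀ (n : ℕ) (M : S.World) (a : Fin n → S.Dom M) (N : T.World) (b : Fin n → T.Dom N),
    R n M a N b →
      AtomicEquiv L a b ∧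
      (∀ c : S.Dom M, ∃ d : T.Dom N, R (n + 1) M (Fin.snoc a c) N (Fin.snoc b d)) ∧
      (∀ d : T.Dom N, ∃ c : S.Dom M, R (n + 1) M (Fin.snoc a c) N (Fin.snoc b d)) ∧
      (∀ (M' : S.World) (π : S.Dom M ↪[L] S.Dom M'), π ∈ S.Emb M M' →
        ∃ (N' : T.World) (ρ : T.Dom N ↪[L] T.Dom N'), ρ ∈ T.Emb N N' ∧
          R n M' (fun i => π (a i)) N' (fun i => ρ (b i))) ∧
      (∀ (N' : T.World) (ρ : T.Dom N ↪[L] T.Dom N'), ρ ∈ T.Emb N N' →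
        ∃ (M' : S.World) (π : S.Dom M ↪[L] S.Dom M'), π ∈ S.Emb M M' ∧
          R n M' (fun i => π (a i)) N' (fun i => ρ (b i)))

/-- Two pointed systems are bisimilar if some bisimulation relates them. -/
def Bisimilar.{u, v, w, x, w', x'} {L : FirstOrder.Language.{u, v}}
    (S : PotSys.{u, v, w, x} L) (T : PotSys.{u, v, w', x'} L)
    {n : ℕ} (M : S.World) (a : Fin n → S.Dom M) (N : T.World) (b : Fin n → T.Dom N) : Prop :=
  ∃ R : BisimRel S T, IsBisimulation S T R ∧ R n M a N b

/-- A relation is bitotal if every pair on the left is related to some pair on the right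
and vice versa. -/
def Bitotal.{u, v, w, x, w', x'} {L : FirstOrder.Language.{u, v}}
    (S : PotSys.{u, v, w, x} L) (T : PotSys.{u, v, w', x'} L) (R : BisimRel S T) : Prop :=
  (∀ (n : ℕ) (M : S.World) (a : Fin n → S.Dom M), ∃ N b, R n M a N b) ∧
  (∀ (n : ℕ) (N : T.World) (b : Fin n → T.Dom N), ∃ M a, R n M a N b)

/-- Two potentialist systems are bitotally bisimilar if there is a bitotal bisimulation
between them. -/
def BitotallyBisimilar.{u, v, w, x, w', x'} {L : FirstOrder.Language.{u, v}}
    (S : PotSys.{u, v, w, x} L) (T : PotSys.{u, v, w', x'} L) : Prop :=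
  ∃ R : BisimRel S T, IsBisimulation S T R ∧ Bitotal S T R

/-- An iso-bisimulation between potentialist systems: a nonempty relation between worlds
together with a system of isomorphisms, such that embeddings on either side can be matched
by embeddings on the other side, commuting with the isomorphisms. -/
structure IsoBisim.{u, v, w, x, w', x'} {L : FirstOrder.Language.{u, v}}
    (S : PotSys.{u, v, w, x} L) (T : PotSys.{u, v, w', x'} L) where
  rel : S.World → T.World → Prop
  nonempty : ∃ M N, rel M N
  iso : ∀ {M : S.World} {N : T.World}, rel M N → (S.Dom M ≃[L] T.Dom N)
  forth : ∀ {M : S.World} {N : T.World} (h : rel M N) (M' : S.World)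
      (π : S.Dom M ↪[L] S.Dom M'), π ∈ S.Emb M M' →
      ∃ (N' : T.World) (ρ : T.Dom N ↪[L] T.Dom N') (_ : ρ ∈ T.Emb N N') (h' : rel M' N'),
        ∀ y : S.Dom M, iso h' (π y) = ρ (iso h y)
  back : ∀ {M : S.World} {N : T.World} (h : rel M N) (N' : T.World)
      (ρ : T.Dom N ↪[L] T.Dom N'), ρ ∈ T.Emb N N' →
      ∃ (M' : S.World) (π : S.Dom M ↪[L] S.Dom M') (_ : π ∈ S.Emb M M') (h' : rel M' N'),
        ∀ y : S.Dom M, iso h' (π y) = ρ (iso h y)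

/-- An iso-bisimulation is bitotal if every world on either side takes part in the relation. -/
def IsoBisim.Bitotal.{u, v, w, x, w', x'} {L : FirstOrder.Language.{u, v}}
    {S : PotSys.{u, v, w, x} L} {T : PotSys.{u, v, w', x'} L} (I : IsoBisim S T) : Prop :=
  (∀ M : S.World, ∃ N, I.rel M N) ∧ (∀ N : T.World, ∃ M, I.rel M N)


/-- A model of a theory `T` realized concretely on a (set-sized) subset of a fixed ambient
class `A`. -/
structure CModel.{u, v} (L : FirstOrder.Language.{u, v}) (T : L.Theory)
    (A : Type (max u v + 1)) where
  carrier : Set A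
  small : Small.{max u v} (carrier : Type (max u v + 1))
  struc : L.Structure carrier
  models : @Theory.Model L carrier struc T

attribute [instance] CModel.struc

/-- The substructure potentialist system `Mod(T)`: its worlds are all models of `T` carried
on subsets of the ambient class `A`, and its embeddings are exactly the substructure
inclusion maps. -/
def ModSub.{u, v} (L : FirstOrder.Language.{u, v}) (T : L.Theory)
    (A : Type (max u v + 1)) : PotSys.{u, v, max u v + 1, max u v + 1} L where
  World := CModel L T A
  Dom M := M.carrier
  str M := M.struc
  Emb M N := {f : M.carrier ↪[L] N.carrier | ∀ y : M.carrier, (f y : A) = (y : A)}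
  id_mem M := fun y => rfl
  comp_mem f g hf hg := fun y => (hg (f y)).trans (hf y)

/-- The embedding potentialist system `Mod_e(T)`: its worlds are all models of `T` carried
on subsets of the ambient class `A`, and it contains all `L`-embeddings between them. -/
def ModEmb.{u, v} (L : FirstOrder.Language.{u, v}) (T : L.Theory)
    (A : Type (max u v + 1)) : PotSys.{u, v, max u v + 1, max u v + 1} L where
  World := CModel L T A
  Dom M := M.carrier
  str M := M.struc
  Emb M N := Set.univ
  id_mem M := trivial
  comp_mem _ _ _ _ := trivial

/-- The subsystem `Mod_{κ⁺}(T)` of the substructure potentialist system `Mod(T)` consisting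
of the models of cardinality at most `κ`. -/
def ModSubLe.{u, v} (L : FirstOrder.Language.{u, v}) (T : L.Theory)
    (A : Type (max u v + 1)) (κ : Cardinal.{max u v}) :
    PotSys.{u, v, max u v + 1, max u v + 1} L where
  World := {M : CModel L T A // Cardinal.mk M.carrier ≤ Cardinal.lift.{max u v + 1} κ}
  Dom M := M.1.carrier
  str M := M.1.struc
  Emb M N := {f : M.1.carrier ↪[L] N.1.carrier | ∀ y : M.1.carrier, (f y : A) = (y : A)}
  id_mem M := fun y => rfl
  comp_mem f g hf hg := fun y => (hg (f y)).trans (hf y)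

/-- A structure `M` is `ℵ₀`-saturated if for every finite tuple `ā` of elements of `M`,
every type `p(x)` over the parameters `ā` that is finitely realized in `M` is realized
in `M`. -/
def Aleph0Saturated.{u, v, y} (L : FirstOrder.Language.{u, v}) (M : Type y)
    [L.Structure M] : Prop :=
  ∀ (n : ℕ) (a : Fin n → M) (p : Set (L.Formula (Fin (n + 1)))),
    (∀ s : Finset (L.Formula (Fin (n + 1))), ↑s ⊆ p →
      ∃ c : M, ∀ φ ∈ s, Formula.Realize φ (Fin.snoc a c)) →
    ∃ c : M, ∀ φ ∈ p, Formula.Realize φ (Fin.snoc a c)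

/-- A theory `T` is `κ`-rich, for `κ ≥ |L| + ℵ₀`, if it has an infinite model and all its
models of cardinality `κ` are `ℵ₀`-saturated. -/
def Rich.{u, v} (L : FirstOrder.Language.{u, v}) (T : L.Theory)
    (κ : Cardinal.{max u v}) : Prop :=
  Language.card L + Cardinal.aleph0 ≤ κ ∧
  (∃ (M : Type max u v) (_ : L.Structure M), M ⊨ T ∧ Infinite M) ∧
  ∀ (M : Type max u v) (_ : L.Structure M), M ⊨ T → Cardinal.mk M = κ → Aleph0Saturated L M

/-- A theory is `κ`-categorical if any two of its models of cardinality `κ` are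
isomorphic. -/
def Categorical.{u, v} (L : FirstOrder.Language.{u, v}) (T : L.Theory)
    (κ : Cardinal.{max u v}) : Prop :=
  ∀ (M N : Type max u v) (_ : L.Structure M) (_ : L.Structure N),
    M ⊨ T → N ⊨ T → Cardinal.mk M = κ → Cardinal.mk N = κ → Nonempty (M ≃[L] N)

/-- A theory is `ℵ₀`-categorical if any two of its countably infinite models are
isomorphic. -/
def Aleph0Categorical.{u, v} (L : FirstOrder.Language.{u, v}) (T : L.Theory) : Prop :=
  ∀ (M N : Type max u v) (_ : L.Structure M) (_ : L.Structure N),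
    M ⊨ T → N ⊨ T → Countable M → Infinite M → Countable N → Infinite N →
      Nonempty (M ≃[L] N)

/-- A theory `T` has quantifier elimination if every `L`-formula is `T`-equivalent to a
quantifier-free formula with the same free variables. -/
def HasQE.{u, v} (L : FirstOrder.Language.{u, v}) (T : L.Theory) : Prop :=
  ∀ (n : ℕ) (φ : L.Formula (Fin n)), ∃ ψ : L.Formula (Fin n),
    BoundedFormula.IsQF ψ ∧
    ∀ (M : Type max u v) (_ : L.Structure M), M ⊨ T →
      ∀ a : Fin n → M, Formula.Realize φ a ↔ Formula.Realize ψ a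

/-- The theory of a potentialist system: the set of (finitary, non-modal) `L`-sentences
which hold in every world. -/
def ThOf.{u, v, w, x} {L : FirstOrder.Language.{u, v}} (S : PotSys.{u, v, w, x} L) :
    L.Theory :=
  {φ : L.Sentence | ∀ W : S.World, S.Dom W ⊨ φ}

section Types

variable {L : FirstOrder.Language}

/-- Two tuples, in possibly different structures, have the same complete type. -/
def SameType (L : FirstOrder.Language) {M N : Type*} [L.Structure M] [L.Structure N]
    {α : Type*} (a : α → M) (b : α → N) : Prop :=
  ∀ φ : L.Formula α, φ.Realize a ↔ φ.Realize b

namespace SameType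

variable {M N P : Type*} [L.Structure M] [L.Structure N] [L.Structure P] {α : Type*}
  {a : α → M} {b : α → N} {c : α → P}

theorem symm (h : SameType L a b) : SameType L b a := fun φ => (h φ).symm

theorem trans (h : SameType L a b) (h' : SameType L b c) : SameType L a c :=
  fun φ => (h φ).trans (h' φ)

theorem of_elementary (f : M ↪ₑ[L] N) (a : α → M) : SameType L a (fun i => f (a i)) :=
  fun φ => (f.map_formula φ a).symm

theorem of_equiv (e : M ≃[L] N) (a : α → M) : SameType L a (fun i => e (a i)) :=
  of_elementary e.toElementaryEmbedding a

/-- Finitely many formulas with parameters `a` that are satisfied in `M` are satisfied in `N`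
with the parameters replaced by a tuple of the same type. -/
theorem exists_realize_finset [Nonempty N] {β : Type*} (h : SameType L a b) (g : β → M)
    (t : Finset (L.Formula (α ⊕ β))) (ht : ∀ φ ∈ t, φ.Realize (Sum.elim a g)) :
    ∃ g' : β → N, ∀ φ ∈ t, φ.Realize (Sum.elim b g') := by
  classical
  let χ : L.Formula (α ⊕ β) := Formula.iInf (fun φ : t => φ.1)
  have hχ : χ.Realize (Sum.elim a g) := by
    rw [Formula.realize_iInf]
    exact fun φ => ht φ.1 φ.2
  let s := BoundedFormula.freeVarFinset χ
  let r : s → α ⊕ s := fun x => match x with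
    | ⟨Sum.inl y, _⟩ => Sum.inl y
    | ⟨Sum.inr y, hy⟩ => Sum.inr ⟨Sum.inr y, hy⟩
  let ψ : L.Formula (α ⊕ s) := BoundedFormula.restrictFreeVar χ r
  have hψ : (Formula.iExs s ψ).Realize a := by
    rw [Formula.realize_iExs]
    refine ⟨fun x => Sum.elim a g x.1, ?_⟩
    refine (BoundedFormula.realize_restrictFreeVar (Sum.elim a g) ?_).2 hχ
    rintro ⟨y | y, hy⟩ <;> rfl
  rw [h, Formula.realize_iExs] at hψ
  obtain ⟨w, hw⟩ := hψ
  let g' : β → N := fun y => if hy : Sum.inr y ∈ s then w ⟨Sum.inr y, hy⟩ else Classical.arbitrary N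
  refine ⟨g', ?_⟩
  have hχ' : χ.Realize (Sum.elim b g') := by
    refine (BoundedFormula.realize_restrictFreeVar (Sum.elim b g') ?_).1 hw
    rintro ⟨y | y, hy⟩
    · rfl
    · simp only [r, g', s, Sum.elim_inr]
      rw [dif_pos hy]
  rw [Formula.realize_iInf] at hχ'
  exact fun φ hφ => hχ' ⟨φ, hφ⟩

end SameType

/-- Compactness, with parameters: a family of formulas with parameters in `Y` that is finitely
satisfiable in `Y` is satisfied in an elementary extension of `Y`. -/
theorem exists_elementary_extension_realize.{u, v, w, x, y} {L : FirstOrder.Language.{u, v}}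
    {Y : Type w} [L.Structure Y] [Nonempty Y]
    {B : Type x} {ι : Type y} (Γ : ι → L.Formula (Y ⊕ B))
    (hΓ : ∀ s : Finset ι, ∃ g : B → Y, ∀ i ∈ s, (Γ i).Realize (Sum.elim id g)) :
    ∃ (K : Type (max w y)) (_ : L.Structure K) (e : Y ↪ₑ[L] K) (g : B → K),
      ∀ i, (Γ i).Realize (Sum.elim e g) := by
  classical
  choose g hg using hΓ
  let U : Ultrafilter (Finset ι) := Ultrafilter.of Filter.atTop
  let K := (U : Filter (Finset ι)).Product (fun _ => Y)
  let d : Y → Finset ι → Y := fun y _ => y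
  let e : Y ↪ₑ[L] K :=
    { toFun := fun y => (d y : K)
      map_formula' := fun n φ x => by
        refine (Ultraproduct.realize_formula_cast (M := fun _ : Finset ι => Y) (u := U) φ
          (fun i => d (x i))).trans ?_
        simp [d] }
  refine ⟨K, inferInstance, e, fun b => ((fun s => g s b : Finset ι → Y) : K), fun i => ?_⟩
  have h := (Ultraproduct.realize_formula_cast (M := fun _ : Finset ι => Y) (u := U) (Γ i)
    (Sum.elim d (fun b s => g s b))).2 ?_
  · refine (iff_of_eq (congrArg _ (funext ?_))).1 h
    rintro (x | x) <;> rfl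
  · have h1 : ∀ᶠ s in (Filter.atTop : Filter (Finset ι)), i ∈ s :=
      (Filter.eventually_ge_atTop {i}).mono fun s hs => hs (Finset.mem_singleton_self i)
    have h2 : ∀ᶠ s in (U : Filter (Finset ι)), i ∈ s := Ultrafilter.of_le Filter.atTop h1
    refine h2.mono ?_
    intro s hs
    convert hg s i hs using 1
    ext (x | x) <;> rfl

/-- If `b` in `X` has the same type as `a` in `M` and `π : M → M'` is an embedding, then `X`
embeds into an elementary extension of `M'` so that `b` is sent to `π a`. -/
theorem exists_amalgam.{u, v, w, x, y, z} {L : FirstOrder.Language.{u, v}}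
    {X : Type w} {M : Type x} {M' : Type y}
    [L.Structure X] [L.Structure M] [L.Structure M'] [Nonempty M] {α : Type z}
    (π : M ↪[L] M') {a : α → M} {b : α → X} (h : SameType L b a) :
    ∃ (K : Type (max u v w y z)) (_ : L.Structure K) (e : M' ↪ₑ[L] K) (f : X ↪[L] K),
      ∀ i, f (b i) = e (π (a i)) := by
  classical
  have : Nonempty M' := ⟨π (Classical.arbitrary M)⟩
  let ι := {φ : L.Formula (α ⊕ X) // φ.Realize (Sum.elim b id) ∧
    ∀ v : α ⊕ X → M, φ.Realize v → φ.Realize (fun i => π (v i))}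
  let Γ : ι → L.Formula (M' ⊕ X) := fun φ => φ.1.relabel (Sum.map (fun i => π (a i)) id)
  obtain ⟨K, _, e, g, hg⟩ := exists_elementary_extension_realize Γ (fun s => by
    obtain ⟨g', hg'⟩ := h.exists_realize_finset id (s.image Subtype.val) (by
      intro φ hφ
      obtain ⟨ψ, -, rfl⟩ := Finset.mem_image.1 hφ
      exact ψ.2.1)
    refine ⟨fun x => π (g' x), fun φ hφ => ?_⟩
    rw [Formula.realize_relabel]
    convert φ.2.2 _ (hg' φ.1 (Finset.mem_image_of_mem _ hφ)) using 1
    ext (x | x) <;> rfl)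
  have key : ∀ φ : L.Formula (α ⊕ X), φ.Realize (Sum.elim b id) →
      (∀ v : α ⊕ X → M, φ.Realize v → φ.Realize (fun i => π (v i))) →
      φ.Realize (Sum.elim (fun i => e (π (a i))) g) := by
    intro φ h1 h2
    have := hg ⟨φ, h1, h2⟩
    rw [Formula.realize_relabel] at this
    convert this using 1
    ext (x | x) <;> rfl
  let var : X → L.Term (α ⊕ X) := fun x => Term.var (Sum.inr x)
  refine ⟨K, inferInstance, e, ⟨⟨g, ?_⟩, ?_, ?_⟩, ?_⟩
  · intro x y hxy
    by_contra hne
    have := key (∼(Term.equal (var x) (var y))) (by simpa [var, Formula.realize_equal] using hne)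
      (fun v hv => by
        simp only [Formula.realize_not, Formula.realize_equal, Term.realize_var, var] at hv ⊢
        exact fun h => hv (π.injective h))
    simp only [Formula.realize_not, Formula.realize_equal, Term.realize_var, var, Sum.elim_inr] at this
    exact this hxy
  · intro n F x
    have := key (Term.equal (Term.func F fun i => var (x i)) (var (Structure.funMap F x)))
      (by simp [var, Formula.realize_equal])
      (fun v hv => by
        simp only [Formula.realize_equal, Term.realize_var, Term.realize_func, var] at hv ⊢
        rw [← hv, π.map_fun]; rfl)
    simp only [Formula.realize_equal, Term.realize_var, Term.realize_func, var, Sum.elim_inr] at this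
    exact this.symm
  · intro n R x
    by_cases hR : Structure.RelMap R x
    · have := key (R.formula fun i => var (x i))
        (by simpa [var, Formula.realize_rel] using hR)
        (fun v hv => by
          simp only [Formula.realize_rel, Term.realize_var, var] at hv ⊢
          exact (π.map_rel R _).2 hv)
      simp only [Formula.realize_rel, Term.realize_var, var, Sum.elim_inr] at this
      exact iff_of_true this hR
    · have := key (∼(R.formula fun i => var (x i)))
        (by simpa [var, Formula.realize_rel] using hR)
        (fun v hv => by
          simp only [Formula.realize_not, Formula.realize_rel, Term.realize_var, var] at hv ⊢
          exact fun h => hv ((π.map_rel R _).1 h))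
      simp only [Formula.realize_not, Formula.realize_rel, Term.realize_var, var, Sum.elim_inr]
        at this
      exact iff_of_false this hR
  · intro i
    have := key (Term.equal (var (b i)) (Term.var (Sum.inl i)))
      (by simp [var, Formula.realize_equal])
      (fun v hv => by
        simp only [Formula.realize_equal, Term.realize_var, var] at hv ⊢
        rw [hv])
    simp only [Formula.realize_equal, Term.realize_var, var, Sum.elim_inr, Sum.elim_inl] at this
    exact this

end Types

section Factor

variable {L : FirstOrder.Language} {X N W : Type*} [L.Structure X] [L.Structure N] [L.Structure W]

/-- An embedding whose range is contained in that of another one factors through it. -/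
theorem exists_embedding_factor (j : W ↪[L] X) (f : N ↪[L] X)
    (h : ∀ y, f y ∈ Set.range j) : ∃ ρ : N ↪[L] W, ∀ y, j (ρ y) = f y := by
  choose ρ hρ using h
  refine ⟨⟨⟨ρ, fun x y hxy => ?_⟩, fun {n} F x => ?_, fun {n} R x => ?_⟩, hρ⟩
  · exact f.injective (by rw [← hρ, ← hρ, hxy])
  · apply j.injective
    rw [hρ, f.map_fun, j.map_fun]
    congr 1
    ext i
    exact (hρ (x i)).symm
  · rw [← f.map_rel, ← j.map_rel]
    exact iff_of_eq (congrArg _ (funext fun i => hρ (x i)))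

/-- An elementary embedding whose range is contained in that of another one factors through
it. -/
theorem exists_elementaryEmbedding_factor (j : W ↪ₑ[L] X) (f : N ↪ₑ[L] X)
    (h : ∀ y, f y ∈ Set.range j) : ∃ ρ : N ↪ₑ[L] W, ∀ y, j (ρ y) = f y := by
  choose ρ hρ using h
  refine ⟨⟨ρ, fun n φ x => ?_⟩, hρ⟩
  rw [← f.map_formula, ← j.map_formula]
  exact iff_of_eq (congrArg _ (funext fun i => hρ (x i)))

end Factor

section DirectLimit

variable {L : FirstOrder.Language} {G : ℕ → Type*} [∀ i, L.Structure (G i)]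
  (f : ∀ i, G i ↪ₑ[L] G (i + 1))

theorem natLERec_realize (i j : ℕ) (h : i ≤ j) {α : Type*} {n : ℕ} (φ : L.BoundedFormula α n)
    (v : α → G i) (xs : Fin n → G i) :
    φ.Realize (DirectedSystem.natLERec (fun i => (f i).toEmbedding) i j h ∘ v)
      (DirectedSystem.natLERec (fun i => (f i).toEmbedding) i j h ∘ xs) ↔ φ.Realize v xs := by
  induction j, h using Nat.le_induction with
  | base => simp [Function.comp_def, Nat.leRecOn_self]
  | succ j h ih =>
    rw [← ih, ← (f j).map_boundedFormula]
    simp [Function.comp_def, Nat.leRecOn_succ h]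

/-- The `n`-th structure of an elementary chain is elementarily embedded in the direct limit. -/
theorem realize_directLimit_of {α : Type*} {n : ℕ} (φ : L.BoundedFormula α n) (i : ℕ)
    (v : α → G i) (xs : Fin n → G i) :
    φ.Realize
      (DirectLimit.of L ℕ G (DirectedSystem.natLERec (fun i => (f i).toEmbedding)) i ∘ v)
      (DirectLimit.of L ℕ G (DirectedSystem.natLERec (fun i => (f i).toEmbedding)) i ∘ xs) ↔
      φ.Realize v xs := by
  induction φ generalizing i with
  | falsum => rfl
  | equal t₁ t₂ =>
    simp only [BoundedFormula.Realize, ← Sum.comp_elim, HomClass.realize_term]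
    exact (DirectLimit.of L ℕ G _ i).injective.eq_iff
  | rel R ts =>
    simp only [BoundedFormula.Realize, ← Sum.comp_elim, HomClass.realize_term]
    exact (DirectLimit.of L ℕ G _ i).map_rel R _
  | imp _ _ ih₁ ih₂ => simp only [BoundedFormula.Realize, ih₁, ih₂]
  | all φ ih =>
    simp only [BoundedFormula.realize_all]
    constructor
    · intro h x
      rw [← ih, Fin.comp_snoc]
      exact h _
    · intro h z
      obtain ⟨j, z, rfl⟩ := DirectLimit.exists_of z
      have hk : ∀ v : G i, DirectLimit.of L ℕ G
          (DirectedSystem.natLERec (fun i => (f i).toEmbedding)) i v = DirectLimit.of L ℕ G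
          (DirectedSystem.natLERec (fun i => (f i).toEmbedding)) (max i j)
            (DirectedSystem.natLERec (fun i => (f i).toEmbedding) i (max i j)
              (le_max_left _ _) v) := fun v => DirectLimit.of_f.symm
      have hz : DirectLimit.of L ℕ G
          (DirectedSystem.natLERec (fun i => (f i).toEmbedding)) j z = DirectLimit.of L ℕ G
          (DirectedSystem.natLERec (fun i => (f i).toEmbedding)) (max i j)
            (DirectedSystem.natLERec (fun i => (f i).toEmbedding) j (max i j)
              (le_max_right _ _) z) := DirectLimit.of_f.symm
      have h' := (natLERec_realize f i (max i j) (le_max_left _ _) φ.all v _).2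
        (BoundedFormula.realize_all.2 h)
      have := BoundedFormula.realize_all.1 h' (DirectedSystem.natLERec
        (fun i => (f i).toEmbedding) j (max i j) (le_max_right _ _) z)
      rw [← ih, Fin.comp_snoc] at this
      rw [hz]
      simpa only [Function.comp_def, hk] using this

end DirectLimit

section Categorical

universe u v

variable {L : FirstOrder.Language.{u, v}} {T : L.Theory} {κ : Cardinal.{max u v}}

/-- If `T` is `κ`-categorical and `W` is a model of cardinality `κ`, then every model of
cardinality at least `κ` has an elementary substructure isomorphic to `W` covering any given
subset of cardinality at most `κ`. -/
theorem Categorical.exists_elementaryEmbedding.{w} (hcat : Categorical L T κ)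
    (hκ : Language.card L + Cardinal.aleph0 ≤ κ)
    {W : Type max u v} [L.Structure W] (hW : W ⊨ T) (hWκ : Cardinal.mk W = κ)
    {X : Type w} [L.Structure X] (hX : X ⊨ T)
    (hXκ : Cardinal.lift.{w} κ ≤ Cardinal.lift.{max u v} (Cardinal.mk X)) (s : Set X)
    (hs : Cardinal.lift.{max u v} (Cardinal.mk s) ≤ Cardinal.lift.{w} κ) :
    ∃ j : W ↪ₑ[L] X, s ⊆ Set.range j := by
  obtain ⟨S, hsS, hS⟩ := exists_elementarySubstructure_card_eq L s κ
    (le_trans (self_le_add_left _ _) hκ) hs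
    (by simpa using le_trans (self_le_add_right _ _) hκ) hXκ
  rw [← Cardinal.mk_out κ] at hS
  obtain ⟨e⟩ := Cardinal.lift_mk_eq'.1 hS
  let _ : L.Structure κ.out := e.inducedStructure
  let e' : S ≃[L] κ.out := e.inducedStructureEquiv
  have hST : S ⊨ T := (S.subtype.theory_model_iff T).2 hX
  have hκT : κ.out ⊨ T := (e'.toElementaryEmbedding.theory_model_iff T).1 hST
  obtain ⟨g⟩ := hcat W κ.out inferInstance inferInstance hW hκT hWκ (Cardinal.mk_out κ)
  refine ⟨S.subtype.comp (e'.symm.comp g).toElementaryEmbedding, fun x hx => ?_⟩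
  refine ⟨g.symm (e' ⟨x, hsS hx⟩), ?_⟩
  simp

theorem natLERec_succ_self {G : Type*} [L.Structure G] (i : G ↪[L] G) (k : ℕ) (x : G) :
    DirectedSystem.natLERec (G' := fun _ : ℕ => G) (fun _ => i) k (k + 1) (Nat.le_succ k) x =
      i x := by
  simp only [DirectedSystem.coe_natLERec]
  exact Nat.leRecOn_succ' (C := fun _ => G) x

theorem elim_comp_snoc {K : Type*} {n : ℕ} (a : Fin n → K) (c : Unit → K) :
    Sum.elim a c ∘ Fin.snoc (α := fun _ => Fin n ⊕ Unit) Sum.inl (Sum.inr ()) =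
      Fin.snoc (α := fun _ => K) a (c ()) := by
  funext k
  refine Fin.lastCases ?_ (fun k => ?_) k <;> simp

/-- A model of cardinality `κ` of a `κ`-categorical theory realizes over each finite tuple
every complete type that is realized, in some structure, over a tuple of the same type. -/
theorem Categorical.exists_snoc_sameType_self.{w} (hcat : Categorical L T κ)
    (hκ : Language.card L + Cardinal.aleph0 ≤ κ)
    {W : Type max u v} [L.Structure W] (hW : W ⊨ T) (hWκ : Cardinal.mk W = κ)
    {X : Type w} [L.Structure X] {n : ℕ} (a : Fin n → X) (c : X) (b : Fin n → W)
    (hab : SameType L a b) :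
    ∃ d : W, SameType L (Fin.snoc (α := fun _ => X) a c) (Fin.snoc (α := fun _ => W) b d) := by
  classical
  have hℵ : Cardinal.aleph0 ≤ κ := le_trans (self_le_add_left _ _) hκ
  have : Infinite W := Cardinal.infinite_iff.2 (hWκ ▸ hℵ)
  -- an elementary self-embedding after which the type is realized over each tuple of the image
  obtain ⟨i, hi⟩ : ∃ i : W ↪ₑ[L] W, ∀ b : Fin n → W, SameType L a b → ∃ d : W,
      SameType L (Fin.snoc (α := fun _ => X) a c)
        (Fin.snoc (α := fun _ => W) (fun k => i (b k)) d) := by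
    let B := {b : Fin n → W // SameType L a b}
    let ι := B × {φ : L.Formula (Fin (n + 1)) // φ.Realize (Fin.snoc (α := fun _ => X) a c)}
    let Γ : ι → L.Formula (W ⊕ B) := fun p => p.2.1.relabel
      (Fin.snoc (α := fun _ => W ⊕ B) (fun k => Sum.inl (p.1.1 k)) (Sum.inr p.1))
    have hΓ : ∀ {K : Type (max u v)} [L.Structure K] (e : W → K) (g : B → K) (p : ι),
        (Γ p).Realize (Sum.elim e g) ↔
          p.2.1.Realize (Fin.snoc (α := fun _ => K) (fun k => e (p.1.1 k)) (g p.1)) := by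
      intro K _ e g p
      rw [Formula.realize_relabel]
      refine iff_of_eq (congrArg _ (funext fun k => ?_))
      refine Fin.lastCases ?_ (fun k => ?_) k <;> simp
    obtain ⟨K, _, e, g, hg⟩ := exists_elementary_extension_realize Γ (fun s => by
      let r : Fin (n + 1) → Fin n ⊕ Unit := Fin.snoc (α := fun _ => Fin n ⊕ Unit) Sum.inl
        (Sum.inr ())
      have hb : ∀ b : B, ∃ d : W, ∀ p ∈ s, p.1 = b →
          p.2.1.Realize (Fin.snoc (α := fun _ => W) b.1 d) := by
        intro b
        obtain ⟨g', hg'⟩ := b.2.exists_realize_finset (fun _ : Unit => c)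
          (s.image fun p => p.2.1.relabel r) (by
            intro φ hφ
            obtain ⟨p, -, rfl⟩ := Finset.mem_image.1 hφ
            rw [Formula.realize_relabel, elim_comp_snoc]
            exact p.2.2)
        refine ⟨g' (), fun p hp hpb => ?_⟩
        have := hg' _ (Finset.mem_image_of_mem _ hp)
        rwa [Formula.realize_relabel, elim_comp_snoc] at this
      choose d hd using hb
      exact ⟨d, fun p hp => (hΓ id d p).2 (hd p.1 p hp rfl)⟩)
    have hK : K ⊨ T := (e.theory_model_iff T).1 hW
    have hKκ : κ ≤ Cardinal.mk K := hWκ ▸ Cardinal.mk_le_of_injective e.injective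
    have hB : Cardinal.mk B ≤ κ := by
      refine (Cardinal.mk_subtype_le _).trans ?_
      have hpow : Cardinal.mk (Fin n → W) = Cardinal.mk W ^ n := by simp
      rw [hpow]
      simpa [hWκ] using Cardinal.power_nat_le (n := n) hℵ
    obtain ⟨j, hj⟩ := hcat.exists_elementaryEmbedding hκ hW hWκ hK (by simpa using hKκ)
      (Set.range e ∪ Set.range g) (by
        simp only [Cardinal.lift_id]
        refine (Cardinal.mk_union_le _ _).trans (Cardinal.add_le_of_le hℵ ?_ ?_)
        · exact Cardinal.mk_range_le.trans hWκ.le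
        · exact Cardinal.mk_range_le.trans hB)
    obtain ⟨i, hi⟩ := exists_elementaryEmbedding_factor j e (fun y => hj (Or.inl ⟨y, rfl⟩))
    refine ⟨i, fun b hb => ?_⟩
    obtain ⟨d, hd⟩ := hj (Or.inr ⟨⟨b, hb⟩, rfl⟩)
    have hsnoc : (fun k => j (Fin.snoc (α := fun _ => W) (fun k => i (b k)) d k)) =
        Fin.snoc (α := fun _ => K) (fun k => e (b k)) (g ⟨b, hb⟩) := by
      funext k
      refine Fin.lastCases ?_ (fun k => ?_) k <;> simp [hi, hd]
    have hle : ∀ φ : L.Formula (Fin (n + 1)), φ.Realize (Fin.snoc (α := fun _ => X) a c) →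
        φ.Realize (Fin.snoc (α := fun _ => W) (fun k => i (b k)) d) := by
      intro φ hφ
      rw [SameType.of_elementary j, hsnoc]
      exact (hΓ e g ⟨⟨b, hb⟩, φ, hφ⟩).1 (hg _)
    refine ⟨d, fun φ => ⟨hle φ, fun h => ?_⟩⟩
    by_contra hn
    exact Formula.realize_not.1 (hle (∼φ) (Formula.realize_not.2 hn)) h
  -- the limit of the iterates of this self-embedding is isomorphic to `W`
  let f : ∀ k : ℕ, W ↪ₑ[L] W := fun _ => i
  let F := DirectedSystem.natLERec (G' := fun _ : ℕ => W) (fun k => (f k).toEmbedding)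
  let D := Language.DirectLimit (fun _ : ℕ => W) F
  let o : ∀ k : ℕ, W ↪ₑ[L] D := fun k =>
    ⟨DirectLimit.of L ℕ (fun _ : ℕ => W) F k, fun m φ x => by
      have := realize_directLimit_of (G := fun _ : ℕ => W) f φ k x default
      rwa [Subsingleton.elim (_ ∘ default) (default : Fin 0 → D)] at this⟩
  have ho : ∀ k x, o (k + 1) (i x) = o k x := fun k x => by
    have := DirectLimit.of_f (L := L) (G := fun _ : ℕ => W) (f := F) (i := k) (j := k + 1)
      (hij := Nat.le_succ k) (x := x)
    rw [show F k (k + 1) (Nat.le_succ k) x = i x from natLERec_succ_self i.toEmbedding k x] at this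
    exact this
  have hD : D ⊨ T := ((o 0).theory_model_iff T).1 hW
  have hDκ : Cardinal.mk D = κ := by
    apply le_antisymm
    · have : Function.Surjective (fun p : ℕ × W => o p.1 p.2) := fun z => by
        obtain ⟨k, x, rfl⟩ := DirectLimit.exists_of z
        exact ⟨(k, x), rfl⟩
      refine (Cardinal.mk_le_of_surjective (α := ULift.{max u v} ℕ × W)
        (f := fun p => o p.1.down p.2) fun z => ?_).trans ?_
      · obtain ⟨⟨k, x⟩, rfl⟩ := this z
        exact ⟨(⟨k⟩, x), rfl⟩
      · rw [Cardinal.mk_prod]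
        simpa [hWκ] using Cardinal.mul_le_of_le hℵ hℵ le_rfl
    · exact hWκ ▸ Cardinal.mk_le_of_injective (o 0).injective
  obtain ⟨g⟩ := hcat W D inferInstance inferInstance hW hD hWκ hDκ
  obtain ⟨k, b', hb'⟩ := DirectLimit.exists_quotient_mk'_sigma_mk'_eq (fun _ : ℕ => W) F
    (fun l => g (b l))
  have hb'' : ∀ l, g (b l) = o k (b' l) := fun l => congrFun hb' l
  have hab' : SameType L a b' := by
    refine (hab.trans (SameType.of_equiv g b)).trans ?_
    simp only [hb'']
    exact (SameType.of_elementary (o k) b').symm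
  obtain ⟨d, hd⟩ := hi b' hab'
  refine ⟨g.symm (o (k + 1) d), hd.trans ((SameType.of_elementary (o (k + 1)) _).trans ?_)⟩
  refine SameType.trans ?_ (SameType.of_equiv g _).symm
  have : (fun l => (o (k + 1)) (Fin.snoc (α := fun _ => W) (fun k => i (b' k)) d l)) =
      fun l => g (Fin.snoc (α := fun _ => W) b (g.symm (o (k + 1) d)) l) := by
    funext l
    refine Fin.lastCases ?_ (fun l => ?_) l
    · simp
    · simp [ho, hb'']
  rw [this]
  exact fun _ => Iff.rfl

/-- A model of cardinality at least `κ` of a `κ`-categorical theory realizes over each finite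
tuple every complete type that is realized, in some structure, over a tuple of the same type. -/
theorem Categorical.exists_snoc_sameType.{w, x} (hcat : Categorical L T κ)
    (hκ : Language.card L + Cardinal.aleph0 ≤ κ)
    {W : Type max u v} [L.Structure W] (hW : W ⊨ T) (hWκ : Cardinal.mk W = κ)
    {X : Type w} [L.Structure X] {Y : Type x} [L.Structure Y] (hY : Y ⊨ T)
    (hYκ : Cardinal.lift.{x} κ ≤ Cardinal.lift.{max u v} (Cardinal.mk Y))
    {n : ℕ} (a : Fin n → X) (c : X) (b : Fin n → Y) (hab : SameType L a b) :
    ∃ d : Y, SameType L (Fin.snoc (α := fun _ => X) a c) (Fin.snoc (α := fun _ => Y) b d) := by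
  have hℵ : Cardinal.aleph0 ≤ κ := le_trans (self_le_add_left _ _) hκ
  obtain ⟨j, hj⟩ := hcat.exists_elementaryEmbedding hκ hW hWκ hY hYκ (Set.range b)
    (le_trans (by simp) (Cardinal.aleph0_le_lift.2 hℵ))
  choose b' hb' using fun k => hj ⟨k, rfl⟩
  obtain rfl : (fun k => j (b' k)) = b := funext hb'
  obtain ⟨d, hd⟩ := hcat.exists_snoc_sameType_self hκ hW hWκ a c b'
    (hab.trans (SameType.of_elementary j b').symm)
  refine ⟨j d, hd.trans ((SameType.of_elementary j _).trans ?_)⟩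
  have : (fun l => j (Fin.snoc (α := fun _ => W) b' d l)) =
      Fin.snoc (α := fun _ => Y) (fun k => j (b' k)) (j d) := by
    funext l
    refine Fin.lastCases ?_ (fun l => ?_) l <;> simp
  rw [this]
  exact fun _ => Iff.rfl

end Categorical

section Collapse

universe u v

variable {L : FirstOrder.Language.{u, v}} {T : L.Theory} {A : Type (max u v + 1)}

/-- A set-sized model of `T` that injects into `A` is isomorphic to a model carried by the range
of the injection. -/
theorem exists_cmodel_equiv {K : Type max u v} [L.Structure K] (hK : K ⊨ T) (h : K → A)
    (hinj : Function.Injective h) :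
    ∃ (M : CModel L T A) (e : M.carrier ≃[L] K), ∀ k, ((e.symm k : M.carrier) : A) = h k := by
  let E : K ≃ Set.range h := Equiv.ofInjective h hinj
  let _ : L.Structure (Set.range h) := E.inducedStructure
  let e : K ≃[L] Set.range h := E.inducedStructureEquiv
  exact ⟨⟨Set.range h, inferInstance, inferInstance,
    (e.toElementaryEmbedding.theory_model_iff T).1 hK⟩, e.symm, fun k => rfl⟩

/-- A set-sized type injects into a class that is not set-sized. -/
theorem exists_injective_of_not_small.{w, x} {B : Type x} (hB : ¬ Small.{w} B) (K : Type w) :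
    ∃ g : K → B, Function.Injective g := by
  rcases Function.Embedding.total K B with ⟨⟨g⟩⟩ | ⟨⟨g⟩⟩
  · exact ⟨g, g.injective⟩
  · exact absurd (small_of_injective g.injective) hB

/-- Any embedding of a world of `Mod(T)` into a set-sized model of `T` is, up to isomorphism,
the inclusion into a larger world. -/
theorem exists_modSub_emb (hA : ¬ Small.{max u v} A) (M : (ModSub L T A).World)
    {K : Type max u v} [L.Structure K] (hK : K ⊨ T) (f : (ModSub L T A).Dom M ↪[L] K) :
    ∃ (M' : (ModSub L T A).World) (π : (ModSub L T A).Dom M ↪[L] (ModSub L T A).Dom M')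
      (e : (ModSub L T A).Dom M' ≃[L] K), π ∈ (ModSub L T A).Emb M M' ∧ ∀ y, e (π y) = f y := by
  change CModel L T A at M
  change M.carrier ↪[L] K at f
  classical
  have hB : ¬ Small.{max u v} (M.carrierᶜ : Set A) := fun hs => hA <| by
    have := M.small
    have h := small_union.{max u v} M.carrier M.carrierᶜ
    rw [Set.union_compl_self] at h
    exact small_of_injective (Equiv.Set.univ A).symm.injective
  obtain ⟨g, hg⟩ := exists_injective_of_not_small.{max u v} hB K
  let h : K → A := fun k => if hk : ∃ y, f y = k then hk.choose else g k
  have hf : ∀ y, h (f y) = y := fun y => by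
    have hy : ∃ z, f z = f y := ⟨y, rfl⟩
    simp only [h, dif_pos hy]
    exact congrArg Subtype.val (f.injective hy.choose_spec)
  have hn : ∀ k, (¬ ∃ y, f y = k) → h k = g k := fun k hk => dif_neg hk
  have hinj : Function.Injective h := by
    intro k l hkl
    by_cases hk : ∃ y, f y = k <;> by_cases hl : ∃ y, f y = l
    · obtain ⟨y, rfl⟩ := hk
      obtain ⟨z, rfl⟩ := hl
      rw [hf, hf] at hkl
      rw [Subtype.ext hkl]
    · obtain ⟨y, rfl⟩ := hk
      rw [hf, hn l hl] at hkl
      exact absurd (hkl ▸ y.2) (g l).2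
    · obtain ⟨y, rfl⟩ := hl
      rw [hf, hn k hk] at hkl
      exact absurd (hkl ▸ y.2) (g k).2
    · rw [hn k hk, hn l hl] at hkl
      exact hg (Subtype.ext hkl)
  obtain ⟨M', e, he⟩ := exists_cmodel_equiv hK h hinj
  refine ⟨M', (e.symm.toEmbedding.comp f : M.carrier ↪[L] M'.carrier), e, fun y => ?_, fun y => ?_⟩
  · exact (he (f y)).trans (hf y)
  · exact e.apply_symm_apply (f y)

theorem modSub_models (M : (ModSub L T A).World) : (ModSub L T A).Dom M ⊨ T :=
  CModel.models M

/-- A model of `T` of cardinality less than `κ`, carried by a subset of a fixed set of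
cardinality `κ`. -/
structure SmallModel (L : FirstOrder.Language.{u, v}) (T : L.Theory)
    (κ : Cardinal.{max u v}) where
  carrier : Set κ.out
  struc : L.Structure carrier
  models : @Theory.Model L carrier struc T
  card_lt : Cardinal.mk carrier < κ

/-- The potentialist system whose worlds are `W` and representatives of all models of `T` of
cardinality less than `κ`, with all embeddings between them. -/
def collapse (L : FirstOrder.Language.{u, v}) (T : L.Theory) (κ : Cardinal.{max u v})
    (W : Type max u v) [L.Structure W] : PotSys.{u, v, max u v, max u v} L where
  World := Option (SmallModel L T κ)
  Dom := fun
    | none => W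
    | some S => S.carrier
  str := fun
    | none => inferInstanceAs (L.Structure W)
    | some S => S.struc
  Emb _ _ := Set.univ
  id_mem _ := trivial
  comp_mem _ _ _ _ := trivial

theorem exists_collapse_equiv.{w} {κ : Cardinal.{max u v}} {W : Type max u v} [L.Structure W]
    {K : Type w} [L.Structure K] (hK : K ⊨ T)
    (hκ : Cardinal.lift.{max u v} (Cardinal.mk K) < Cardinal.lift.{w} κ) :
    ∃ N, Nonempty (K ≃[L] (collapse L T κ W).Dom N) := by
  have hle := hκ.le
  rw [← Cardinal.mk_out κ] at hle
  obtain ⟨h⟩ := Cardinal.lift_mk_le'.1 hle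
  let E : K ≃ Set.range h := Equiv.ofInjective h h.injective
  let _ : L.Structure (Set.range h) := E.inducedStructure
  let e : K ≃[L] Set.range h := E.inducedStructureEquiv
  refine ⟨some ⟨Set.range h, inferInstance, (e.toElementaryEmbedding.theory_model_iff T).1 hK,
    ?_⟩, ⟨e⟩⟩
  rw [← Cardinal.lift_lt.{max u v, w}]
  exact (Cardinal.lift_mk_eq'.2 ⟨E⟩).symm.trans_lt hκ

/-- The relation collapsing `Mod(T)`: models of cardinality less than `κ` are related by
isomorphisms, and tuples in larger models are related to tuples in `W₀` of the same type. -/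
def CollapseRel (T : L.Theory) (A : Type (max u v + 1)) (κ : Cardinal.{max u v})
    (N : PotSys.{u, v, max u v, max u v} L) (W₀ : N.World) :
    BisimRel (ModSub L T A) N := fun _ M a W b =>
  (Cardinal.lift.{max u v} (Cardinal.mk ((ModSub L T A).Dom M)) < Cardinal.lift.{max u v + 1} κ ∧
    ∃ e : (ModSub L T A).Dom M ≃[L] N.Dom W, ∀ i, e (a i) = b i) ∨
  (W = W₀ ∧
    Cardinal.lift.{max u v + 1} κ ≤ Cardinal.lift.{max u v} (Cardinal.mk ((ModSub L T A).Dom M)) ∧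
    SameType L a b)

section

variable {κ : Cardinal.{max u v}} {N : PotSys.{u, v, max u v, max u v} L} {W₀ : N.World}

theorem CollapseRel.sameType {n : ℕ} {M : (ModSub L T A).World} {a : Fin n → (ModSub L T A).Dom M}
    {W : N.World} {b : Fin n → N.Dom W} (h : CollapseRel T A κ N W₀ n M a W b) :
    SameType L a b := by
  obtain ⟨-, e, he⟩ | ⟨-, -, h⟩ := h
  · rw [← funext he]
    exact SameType.of_equiv e a
  · exact h

/-- If `W₀` has cardinality `κ` and all other worlds of `N` are smaller, then tuples matched by an
isomorphism of their worlds are related by `CollapseRel`. -/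
theorem CollapseRel.of_equiv (hlt : ∀ W : N.World, W ≠ W₀ → Cardinal.mk (N.Dom W) < κ)
    (hW₀ : Cardinal.mk (N.Dom W₀) = κ)
    {n : ℕ} {M : (ModSub L T A).World} {a : Fin n → (ModSub L T A).Dom M}
    {W : N.World} {b : Fin n → N.Dom W} (e : (ModSub L T A).Dom M ≃[L] N.Dom W)
    (he : ∀ i, e (a i) = b i) : CollapseRel T A κ N W₀ n M a W b := by
  have hc := Cardinal.lift_mk_eq'.2 ⟨e.toEquiv⟩
  by_cases hW : W = W₀
  · subst hW
    refine Or.inr ⟨rfl, ?_, ?_⟩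
    · rw [hc, hW₀]
    · rw [← funext he]
      exact SameType.of_equiv e a
  · refine Or.inl ⟨?_, e, he⟩
    rw [hc, Cardinal.lift_lt]
    exact hlt W hW

theorem le_mk_of_embedding.{w, x, y} {κ : Cardinal.{w}} {M : Type x} {M' : Type y}
    [L.Structure M] [L.Structure M'] (π : M ↪[L] M')
    (h : Cardinal.lift.{x} κ ≤ Cardinal.lift.{w} (Cardinal.mk M)) :
    Cardinal.lift.{y} κ ≤ Cardinal.lift.{w} (Cardinal.mk M') := by
  have h1 := Cardinal.lift_mk_le'.2 ⟨π.toEmbedding⟩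
  rw [← Cardinal.lift_le.{max w x}]
  rw [← Cardinal.lift_le.{y}] at h
  rw [← Cardinal.lift_le.{w}] at h1
  simp only [Cardinal.lift_lift] at h h1 ⊢
  rw [← Cardinal.lift_le.{max w x y}] at h h1 ⊢
  simp only [Cardinal.lift_lift] at h h1 ⊢
  exact h.trans h1

theorem collapseRel_isBisimulation (hA : ¬ Small.{max u v} A)
    (hκ : Language.card L + Cardinal.aleph0 ≤ κ) (hcat : Categorical L T κ)
    (hT : ∀ W : N.World, N.Dom W ⊨ T)
    (hlt : ∀ W : N.World, W ≠ W₀ → Cardinal.mk (N.Dom W) < κ)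
    (hW₀ : Cardinal.mk (N.Dom W₀) = κ)
    (hEmb : ∀ (W W' : N.World) (ρ : N.Dom W ↪[L] N.Dom W'), ρ ∈ N.Emb W W')
    (hrep : ∀ M : (ModSub L T A).World,
      Cardinal.lift.{max u v} (Cardinal.mk ((ModSub L T A).Dom M)) <
        Cardinal.lift.{max u v + 1} κ →
      ∃ W, Nonempty ((ModSub L T A).Dom M ≃[L] N.Dom W))
    (hne : ∃ n M a W b, CollapseRel T A κ N W₀ n M a W b) :
    IsBisimulation (ModSub L T A) N (CollapseRel T A κ N W₀) := by
  have hℵ : Cardinal.aleph0 ≤ κ := le_trans (self_le_add_left _ _) hκ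
  have hinf : Infinite (N.Dom W₀) := Cardinal.infinite_iff.2 (hW₀ ▸ hℵ)
  refine ⟨hne, fun n M a W b h => ⟨fun φ _ => h.sameType φ, ?_, ?_, ?_, ?_⟩⟩
  · intro c
    obtain ⟨-, e, he⟩ | ⟨rfl, hM, h⟩ := h
    · refine ⟨e c, CollapseRel.of_equiv hlt hW₀ e (fun i => ?_)⟩
      refine Fin.lastCases ?_ (fun k => ?_) i <;> simp [he]
    · obtain ⟨d, hd⟩ := hcat.exists_snoc_sameType_self hκ (hT W) hW₀ a c b h
      exact ⟨d, Or.inr ⟨rfl, hM, hd⟩⟩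
  · intro d
    obtain ⟨-, e, he⟩ | ⟨rfl, hM, h⟩ := h
    · refine ⟨e.symm d, CollapseRel.of_equiv hlt hW₀ e (fun i => ?_)⟩
      refine Fin.lastCases ?_ (fun k => ?_) i <;> simp [he]
    · obtain ⟨c, hc⟩ := hcat.exists_snoc_sameType hκ (hT W) hW₀ (modSub_models M) hM b d a h.symm
      exact ⟨c, Or.inr ⟨rfl, hM, hc.symm⟩⟩
  · intro M' π _
    obtain ⟨hM, e, he⟩ | ⟨rfl, hM, h⟩ := h
    · by_cases hM' : Cardinal.lift.{max u v} (Cardinal.mk ((ModSub L T A).Dom M')) <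
          Cardinal.lift.{max u v + 1} κ
      · obtain ⟨W', ⟨e'⟩⟩ := hrep M' hM'
        refine ⟨W', (e'.toEmbedding.comp π).comp e.symm.toEmbedding, hEmb _ _ _,
          CollapseRel.of_equiv hlt hW₀ e' (fun i => ?_)⟩
        rw [← he]
        simp
      · obtain ⟨j, hj⟩ := hcat.exists_elementaryEmbedding hκ (hT W₀) hW₀ (modSub_models M')
          (not_lt.1 hM') (Set.range π) (by
            refine le_trans ?_ hM.le
            exact Cardinal.lift_le.2 Cardinal.mk_range_le)
        obtain ⟨ρ, hρ⟩ := exists_embedding_factor j.toEmbedding (π.comp e.symm.toEmbedding)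
          (fun y => hj ⟨e.symm y, rfl⟩)
        refine ⟨W₀, ρ, hEmb _ _ _, Or.inr ⟨rfl, not_lt.1 hM', ?_⟩⟩
        have hb : (fun i => π (a i)) = fun i => j (ρ (b i)) := funext fun i => by
          refine Eq.trans ?_ (hρ (b i)).symm
          rw [← he]
          simp
        rw [hb]
        exact (SameType.of_elementary j _).symm
    · have hMne : Nonempty ((ModSub L T A).Dom M) := by
        have := (Cardinal.aleph0_le_lift.2 hℵ).trans hM
        have := Cardinal.infinite_iff.2 (Cardinal.aleph0_le_lift.1 this)
        infer_instance
      obtain ⟨K, _, e, f, hf⟩ := exists_amalgam π h.symm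
      have hK : K ⊨ T := (e.theory_model_iff T).1 (modSub_models M')
      have hM' := le_mk_of_embedding π hM
      obtain ⟨j, hj⟩ := hcat.exists_elementaryEmbedding hκ (hT W) hW₀ hK
        (le_mk_of_embedding e.toEmbedding hM') (Set.range f) (by
          have := Cardinal.mk_range_le_lift (f := f)
          rw [hW₀] at this
          simpa using this)
      obtain ⟨ρ, hρ⟩ := exists_embedding_factor j.toEmbedding f (fun y => hj ⟨y, rfl⟩)
      refine ⟨W, ρ, hEmb _ _ _, Or.inr ⟨rfl, hM', ?_⟩⟩
      have h1 := SameType.of_elementary (L := L) e (fun i => π (a i))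
      have h2 := SameType.of_elementary (L := L) j (fun i => ρ (b i))
      have h3 : (fun i => e (π (a i))) = fun i => j (ρ (b i)) := funext fun i =>
        (hf i).symm.trans (hρ (b i)).symm
      rw [h3] at h1
      exact h1.trans h2.symm
  · intro W' ρ _
    obtain ⟨hM, e, he⟩ | ⟨rfl, hM, h⟩ := h
    · obtain ⟨M', π, e', hπ, he'⟩ := exists_modSub_emb hA M (hT W') (ρ.comp e.toEmbedding)
      refine ⟨M', π, hπ, CollapseRel.of_equiv hlt hW₀ e' (fun i => ?_)⟩
      exact (he' (a i)).trans (congrArg ρ (he i))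
    · have hW' : W' = W := by
        by_contra hne
        exact absurd (Cardinal.mk_le_of_injective ρ.injective) (not_le.2 (hW₀ ▸ hlt W' hne))
      subst hW'
      have : Small.{max u v} ((ModSub L T A).Dom M) := CModel.small M
      let X := Shrink.{max u v} ((ModSub L T A).Dom M)
      let _ : L.Structure X := (equivShrink ((ModSub L T A).Dom M)).inducedStructure
      let eX : (ModSub L T A).Dom M ≃[L] X :=
        (equivShrink ((ModSub L T A).Dom M)).inducedStructureEquiv
      obtain ⟨K, _, e, f, hf⟩ := exists_amalgam ρ ((SameType.of_equiv eX a).symm.trans h)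
      have hK : K ⊨ T := (e.theory_model_iff T).1 (hT W')
      obtain ⟨M', π, e', hπ, he'⟩ := exists_modSub_emb hA M hK (f.comp eX.toEmbedding)
      refine ⟨M', π, hπ, Or.inr ⟨rfl, le_mk_of_embedding π hM, ?_⟩⟩
      have h1 := SameType.of_equiv (L := L) e' (fun i => π (a i))
      have h2 := SameType.of_elementary (L := L) e (fun i => ρ (b i))
      have h3 : (fun i => e' (π (a i))) = fun i => e (ρ (b i)) := funext fun i =>
        (he' (a i)).trans (hf i)
      rw [h3] at h1
      exact h1.trans h2.symm

theorem collapseRel_bitotal (hA : ¬ Small.{max u v} A)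
    (hκ : Language.card L + Cardinal.aleph0 ≤ κ) (hcat : Categorical L T κ)
    (hT : ∀ W : N.World, N.Dom W ⊨ T)
    (hlt : ∀ W : N.World, W ≠ W₀ → Cardinal.mk (N.Dom W) < κ)
    (hW₀ : Cardinal.mk (N.Dom W₀) = κ)
    (hrep : ∀ M : (ModSub L T A).World,
      Cardinal.lift.{max u v} (Cardinal.mk ((ModSub L T A).Dom M)) <
        Cardinal.lift.{max u v + 1} κ →
      ∃ W, Nonempty ((ModSub L T A).Dom M ≃[L] N.Dom W)) :
    Bitotal (ModSub L T A) N (CollapseRel T A κ N W₀) := by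
  have hℵ : Cardinal.aleph0 ≤ κ := le_trans (self_le_add_left _ _) hκ
  refine ⟨fun n M a => ?_, fun n W b => ?_⟩
  · by_cases hM : Cardinal.lift.{max u v} (Cardinal.mk ((ModSub L T A).Dom M)) <
      Cardinal.lift.{max u v + 1} κ
    · obtain ⟨W, ⟨e⟩⟩ := hrep M hM
      exact ⟨W, fun i => e (a i), CollapseRel.of_equiv hlt hW₀ e fun _ => rfl⟩
    · obtain ⟨j, hj⟩ := hcat.exists_elementaryEmbedding hκ (hT W₀) hW₀ (modSub_models M)
        (not_lt.1 hM) (Set.range a)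
        (le_trans (by simp) (Cardinal.aleph0_le_lift.2 hℵ))
      choose b hb using fun i => hj ⟨i, rfl⟩
      refine ⟨W₀, b, Or.inr ⟨rfl, not_lt.1 hM, ?_⟩⟩
      rw [← funext hb]
      exact (SameType.of_elementary j b).symm
  · obtain ⟨g, hg⟩ := exists_injective_of_not_small hA (N.Dom W)
    obtain ⟨M, ⟨e⟩⟩ : ∃ M, Nonempty ((ModSub L T A).Dom M ≃[L] N.Dom W) := by
      obtain ⟨M, e, -⟩ := exists_cmodel_equiv (hT W) g hg
      exact ⟨M, ⟨e⟩⟩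
    exact ⟨M, fun i => e.symm (b i), CollapseRel.of_equiv hlt hW₀ e fun i =>
      e.apply_symm_apply (b i)⟩

end

end Collapse

/-- let `κ ≥ |L| + ℵ₀` and let `T` be a `κ`-categorical first-order
`L`-theory with an infinite model.  Then `Mod(T)` is bitotally bisimilar with a potentialist
system all of whose worlds are models of `T` of cardinality less than `κ`, except for
exactly one world, which has cardinality `κ`. -/
theorem categorical_bitotallyBisimilar.{u, v}
    (L : FirstOrder.Language.{u, v}) (T : L.Theory) (A : Type (max u v + 1))
    (hA : ¬ Small.{max u v} A) (κ : Cardinal.{max u v})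
    (hκ : Language.card L + Cardinal.aleph0 ≤ κ)
    (hcat : Categorical L T κ)
    (hinf : ∃ (M : Type max u v) (_ : L.Structure M), M ⊨ T ∧ Infinite M) :
    ∃ (N : PotSys.{u, v, max u v, max u v} L) (W₀ : N.World),
      (∀ W : N.World, N.Dom W ⊨ T) ∧
      (∀ W : N.World, W ≠ W₀ → Cardinal.mk (N.Dom W) < κ) ∧
      Cardinal.mk (N.Dom W₀) = κ ∧
      BitotallyBisimilar (ModSub L T A) N := by
  have hℵ : Cardinal.aleph0 ≤ κ := le_trans (self_le_add_left _ _) hκ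
  obtain ⟨M, _, hM, hMinf⟩ := hinf
  have hMne : Nonempty M := inferInstance
  obtain ⟨W, hWκ⟩ := Theory.exists_model_card_eq (T := T) ⟨⟨M⟩, hMinf⟩ κ hℵ
    (by simpa using le_trans (self_le_add_right _ _) hκ)
  have hT : ∀ N : (collapse L T κ W).World, (collapse L T κ W).Dom N ⊨ T := fun
    | none => W.is_model
    | some S => S.models
  have hlt : ∀ N : (collapse L T κ W).World, N ≠ none →
      Cardinal.mk ((collapse L T κ W).Dom N) < κ := fun
    | none => fun h => absurd rfl h
    | some S => fun _ => S.card_lt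
  have hW₀ : Cardinal.mk ((collapse L T κ W).Dom none) = κ := hWκ
  have hrep : ∀ M : (ModSub L T A).World,
      Cardinal.lift.{max u v} (Cardinal.mk ((ModSub L T A).Dom M)) <
        Cardinal.lift.{max u v + 1} κ →
      ∃ N, Nonempty ((ModSub L T A).Dom M ≃[L] (collapse L T κ W).Dom N) :=
    fun M h => exists_collapse_equiv (modSub_models M) h
  have hbit := collapseRel_bitotal hA hκ hcat hT hlt hW₀ hrep
  obtain ⟨M₀, a₀, h₀⟩ := hbit.2 0 none Fin.elim0
  exact ⟨collapse L T κ W, none, hT, hlt, hWκ, CollapseRel T A κ (collapse L T κ W) none,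
    collapseRel_isBisimulation hA hκ hcat hT hlt hW₀ (fun _ _ _ => trivial) hrep
      ⟨0, M₀, a₀, none, Fin.elim0, h₀⟩, hbit⟩

end Potentialist
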